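/- arXiv:1103.2572 — 5 statements merged into one kernel-verified Lean document; each statement's English description precedes it below -/
import Mathlib

section
/- If a graph G is n-e.c. with n ≥ 2, then for every vertex x of G, the subgraph induced on the neighbourhood of x is (n−1)-e.c. -/
/-- A graph `G` is `n`-e.c. (`n`-existentially complete) if for every pair of
disjoint sets `A` and `B` of vertices with `|A ∪ B| = n`, there is a vertex `z`
outside `A ∪ B` adjacent to every vertex of `A` and to no vertex of `B`. -/
def SimpleGraph.IsNEC {V : Type*} [DecidableEq V] (G : SimpleGraph V) (n : ℕ) : Prop :=
  ∀ A B : Finset V, Disjoint A B → (A ∪ B).card = n →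
    ∃ z ∉ A ∪ B, (∀ a ∈ A, G.Adj z a) ∧ ∀ b ∈ B, ¬ G.Adj z b

/-- If a graph `G` is `n`-e.c. with `n ≥ 2`, then for every vertex `x` of `G`,
the subgraph induced on the neighbourhood of `x` is `(n-1)`-e.c. -/
theorem stmt_2 {V : Type*} [DecidableEq V] (G : SimpleGraph V) (n : ℕ)
    (hn : 2 ≤ n) (h : G.IsNEC n) (x : V) :
    (G.induce (G.neighborSet x)).IsNEC (n - 1) := by
  intro A B hAB hc
  have hinj : Function.Injective (Subtype.val : G.neighborSet x → V) :=
    Subtype.val_injective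
  have hx : ∀ S : Finset (G.neighborSet x), x ∉ S.image Subtype.val := by
    intro S hS
    obtain ⟨y, -, hy⟩ := Finset.mem_image.1 hS
    have h1 : G.Adj x y.1 := y.2
    rw [hy] at h1
    exact G.loopless.irrefl x h1
  have hd : Disjoint (insert x (A.image Subtype.val)) (B.image Subtype.val) := by
    rw [Finset.disjoint_insert_left]
    exact ⟨hx B, (Finset.disjoint_image hinj).2 hAB⟩
  have hcard : (insert x (A.image Subtype.val) ∪ B.image Subtype.val).card = n := by
    rw [Finset.insert_union, ← Finset.image_union, Finset.card_insert_of_notMem (hx _),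
      Finset.card_image_of_injective _ hinj, hc]
    omega
  obtain ⟨z, hz, hzA, hzB⟩ := h _ _ hd hcard
  refine ⟨⟨z, (hzA x (Finset.mem_insert_self _ _)).symm⟩, ?_, ?_, ?_⟩
  · intro hm
    apply hz
    rw [Finset.insert_union, ← Finset.image_union]
    exact Finset.mem_insert_of_mem (Finset.mem_image_of_mem Subtype.val hm)
  · intro a ha
    exact hzA a.1 (Finset.mem_insert_of_mem (Finset.mem_image_of_mem Subtype.val ha))
  · intro b hb hadj
    exact hzB b.1 (Finset.mem_image_of_mem Subtype.val hb) hadj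
end

section
/- For every positive integer r, the symplectic graph Sp(2r) is not 3-e.c. More precisely, if x₁ and x₂ are distinct vertices of Sp(2r) and x₃ = x₁ + x₂, then x₃ is a vertex of Sp(2r) distinct from x₁ and x₂, and no vertex of Sp(2r) is adjacent to all three of x₁, x₂, x₃. -/
open Matrix

/-- The `2r × 2r` block diagonal matrix over `𝔽₂` (with rows and columns indexed by
`Fin r × Fin 2`) having `r` diagonal blocks equal to `!![0, 1; 1, 0]`. -/
def sympMatrix (r : ℕ) : Matrix (Fin r × Fin 2) (Fin r × Fin 2) (ZMod 2) :=
  fun x y => if x.1 = y.1 ∧ x.2 ≠ y.2 then 1 else 0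

lemma sympMatrix_transpose (r : ℕ) : (sympMatrix r)ᵀ = sympMatrix r := by
  ext x y
  simp only [sympMatrix, Matrix.transpose_apply]
  by_cases h : x.1 = y.1 <;> by_cases h' : x.2 = y.2 <;>
    simp [h, h', eq_comm, Ne, fun a b => (@eq_comm (Fin 2) a b)]

/-- The symplectic graph `Sp(2r)`: vertices are the nonzero vectors of `𝔽₂^{2r}`,
and `x`, `y` are adjacent iff `x ≠ y` and `xᵀ N y = 1`. -/
def Sp (r : ℕ) : SimpleGraph {x : Fin r × Fin 2 → ZMod 2 // x ≠ 0} where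
  Adj x y := x ≠ y ∧
    (x : Fin r × Fin 2 → ZMod 2) ⬝ᵥ (sympMatrix r *ᵥ (y : Fin r × Fin 2 → ZMod 2)) = 1
  symm := by
    refine ⟨?_⟩
    rintro x y ⟨hxy, hform⟩
    refine ⟨hxy.symm, ?_⟩
    calc (y : Fin r × Fin 2 → ZMod 2) ⬝ᵥ (sympMatrix r *ᵥ (x : Fin r × Fin 2 → ZMod 2))
        = (sympMatrix r *ᵥ (x : Fin r × Fin 2 → ZMod 2)) ⬝ᵥ (y : Fin r × Fin 2 → ZMod 2) :=
          dotProduct_comm _ _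
      _ = ((x : Fin r × Fin 2 → ZMod 2) ᵥ* (sympMatrix r)ᵀ) ⬝ᵥ (y : Fin r × Fin 2 → ZMod 2) := by
          rw [Matrix.vecMul_transpose]
      _ = ((x : Fin r × Fin 2 → ZMod 2) ᵥ* sympMatrix r) ⬝ᵥ (y : Fin r × Fin 2 → ZMod 2) := by
          rw [sympMatrix_transpose]
      _ = (x : Fin r × Fin 2 → ZMod 2) ⬝ᵥ (sympMatrix r *ᵥ (y : Fin r × Fin 2 → ZMod 2)) :=
          (Matrix.dotProduct_mulVec _ _ _).symm
      _ = 1 := hform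
  loopless := by refine ⟨?_⟩; rintro x ⟨hx, -⟩; exact hx rfl

/-- For every positive integer `r`, the symplectic graph `Sp(2r)` is not 3-e.c.
More precisely, if `x₁` and `x₂` are distinct vertices and `x₃ = x₁ + x₂`, then
`x₃` is a vertex of `Sp(2r)` distinct from `x₁` and `x₂`, and no vertex of
`Sp(2r)` is adjacent to all three of `x₁`, `x₂`, `x₃`. -/
theorem stmt_4 (r : ℕ) (hr : 1 ≤ r)
    (x₁ x₂ : {x : Fin r × Fin 2 → ZMod 2 // x ≠ 0}) (hne : x₁ ≠ x₂) :
    ¬ (Sp r).IsNEC 3 ∧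
    ∃ h₃ : (x₁ : Fin r × Fin 2 → ZMod 2) + (x₂ : Fin r × Fin 2 → ZMod 2) ≠ 0,
      (⟨(x₁ : Fin r × Fin 2 → ZMod 2) + (x₂ : Fin r × Fin 2 → ZMod 2), h₃⟩ :
        {x : Fin r × Fin 2 → ZMod 2 // x ≠ 0}) ≠ x₁ ∧
      (⟨(x₁ : Fin r × Fin 2 → ZMod 2) + (x₂ : Fin r × Fin 2 → ZMod 2), h₃⟩ :
        {x : Fin r × Fin 2 → ZMod 2 // x ≠ 0}) ≠ x₂ ∧
      ¬ ∃ z, (Sp r).Adj z x₁ ∧ (Sp r).Adj z x₂ ∧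
        (Sp r).Adj z
          ⟨(x₁ : Fin r × Fin 2 → ZMod 2) + (x₂ : Fin r × Fin 2 → ZMod 2), h₃⟩ := by
  have h₃ : (x₁ : Fin r × Fin 2 → ZMod 2) + (x₂ : Fin r × Fin 2 → ZMod 2) ≠ 0 := by
    intro h
    apply hne
    apply Subtype.ext
    funext i
    have hi := congrFun h i
    simp only [Pi.add_apply, Pi.zero_apply] at hi
    generalize x₁.1 i = a at hi ⊢
    generalize x₂.1 i = b at hi ⊢
    revert a b
    decide
  have h31 : (⟨_, h₃⟩ : {x : Fin r × Fin 2 → ZMod 2 // x ≠ 0}) ≠ x₁ := by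
    intro h
    exact x₂.2 (by simpa using congrArg Subtype.val h)
  have h32 : (⟨_, h₃⟩ : {x : Fin r × Fin 2 → ZMod 2 // x ≠ 0}) ≠ x₂ := by
    intro h
    exact x₁.2 (by simpa using congrArg Subtype.val h)
  have key : ¬ ∃ z, (Sp r).Adj z x₁ ∧ (Sp r).Adj z x₂ ∧ (Sp r).Adj z ⟨_, h₃⟩ := by
    rintro ⟨z, ⟨-, h1⟩, ⟨-, h2⟩, ⟨-, h3⟩⟩
    simp only [Matrix.mulVec_add, dotProduct_add] at h3
    rw [h1, h2] at h3
    exact absurd h3 (by decide)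
  refine ⟨?_, h₃, h31, h32, key⟩
  intro hec
  obtain ⟨z, -, hz, -⟩ := hec {x₁, x₂, ⟨_, h₃⟩} ∅ (by simp) (by
    rw [Finset.union_empty]
    exact Finset.card_eq_three.mpr ⟨_, _, _, hne, h31.symm, h32.symm, rfl⟩)
  exact key ⟨z, hz _ (by simp), hz _ (by simp), hz _ (by simp)⟩
end

section
/- A strongly regular graph G with parameters (v, k, λ, μ) is 2-e.c. if and only if both G and its complement are connected and both G and its complement contain a triangle. -/
theorem aux0 {V : Type*} (H : SimpleGraph V) (hc : H.Connected)
    (ht : ∀ x y z, H.Adj x y → H.Adj y z → x ≠ z → H.Adj x z) (x y : V) (h : x ≠ y) :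
    H.Adj x y := by
  have hr : Relation.ReflTransGen H.Adj x y := (H.reachable_iff_reflTransGen x y).1 (hc.preconnected x y)
  have : x = y ∨ H.Adj x y := by
    clear h
    induction hr with
    | refl => exact Or.inl rfl
    | tail _ h2 ih =>
      rename_i b c _
      by_cases hxc : x = c
      · exact Or.inl hxc
      · rcases ih with rfl | ih
        · exact Or.inr h2
        · exact Or.inr (ht _ _ _ ih h2 hxc)
  exact this.resolve_left h

theorem aux1 {V : Type*} [Fintype V] [DecidableEq V]
    (H : SimpleGraph V) [DecidableRel H.Adj] (v k l m : ℕ)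
    (hs : H.IsSRGWith v k l m) (hc : H.Connected)
    (hn : ∃ a b : V, a ≠ b ∧ ¬ H.Adj a b)
    (ht : ∃ a b c : V, H.Adj a b ∧ H.Adj b c ∧ H.Adj a c) (a b : V) (hab : a ≠ b) :
    ∃ z, H.Adj z a ∧ H.Adj z b := by
  by_cases h : H.Adj a b
  · obtain ⟨x, y, z, h1, h2, h3⟩ := ht
    have e1 := hs.of_adj x y h1
    have e2 := hs.of_adj a b h
    have : 0 < l := by
      rw [← e1]
      exact Fintype.card_pos_iff.2 ⟨⟨z, h3, h2⟩⟩
    rw [← e2] at this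
    obtain ⟨⟨w, h4, h5⟩⟩ := Fintype.card_pos_iff.1 this
    exact ⟨w, h4.symm, h5.symm⟩
  · by_contra hcon
    have e := hs.of_not_adj hab h
    have hm : m = 0 := by
      rw [← e, Fintype.card_eq_zero_iff]
      exact ⟨fun ⟨w, h4, h5⟩ => hcon ⟨w, h4.symm, h5.symm⟩⟩
    obtain ⟨p, q, hpq, hp⟩ := hn
    refine hp (aux0 H hc ?_ p q hpq)
    intro x y z h1 h2 h3
    by_contra h4
    have e2 := hs.of_not_adj h3 h4
    rw [hm, Fintype.card_eq_zero_iff] at e2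
    exact e2.false ⟨y, h1, h2.symm⟩

theorem aux2 {V : Type*} [Fintype V] [DecidableEq V]
    (H : SimpleGraph V) [DecidableRel H.Adj] (v k l m : ℕ)
    (hs : H.IsSRGWith v k l m) (hc : H.Connected)
    (hn : ∃ a b : V, a ≠ b ∧ ¬ H.Adj a b) (a b : V) (hab : H.Adj a b) :
    ∃ z, z ≠ b ∧ H.Adj z a ∧ ¬ H.Adj z b := by
  by_contra! hcon
  have card : ∀ x y, H.Adj x y → ((H.neighborFinset x).erase y).card = k - 1 := by
    intro x y h
    rw [Finset.card_erase_of_mem (by simpa using h), H.card_neighborFinset_eq_degree,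
      hs.regular.degree_eq]
  have cn : ∀ x y, H.Adj x y → (H.commonNeighbors x y).toFinset.card = l := by
    intro x y h
    rw [Set.toFinset_card, ← hs.of_adj x y h]
  have sub : ∀ x y, (H.commonNeighbors x y).toFinset ⊆ (H.neighborFinset x).erase y := by
    intro x y z hz
    simp only [Set.mem_toFinset, SimpleGraph.mem_commonNeighbors] at hz
    simp [hz.1, hz.2.ne']
  have hkl : k - 1 ≤ l := by
    rw [← card a b hab, ← cn a b hab]
    apply Finset.card_le_card
    intro z hz
    simp only [Finset.mem_erase, SimpleGraph.mem_neighborFinset] at hz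
    simp only [Set.mem_toFinset, SimpleGraph.mem_commonNeighbors]
    exact ⟨hz.2, (hcon z hz.1 hz.2.symm).symm⟩
  obtain ⟨p, q, hpq, hp⟩ := hn
  refine hp (aux0 H hc ?_ p q hpq)
  intro x y z h1 h2 h3
  have e := Finset.eq_of_subset_of_card_le (sub y x)
    (by rw [card y x h1.symm, cn y x h1.symm]; exact hkl)
  have hz : z ∈ (H.neighborFinset y).erase x := by simp [h2, h3.symm]
  rw [← e] at hz
  simp only [Set.mem_toFinset, SimpleGraph.mem_commonNeighbors] at hz
  exact hz.2

theorem aux3 {V : Type*} (H : SimpleGraph V)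
    (he : ∃ a b : V, H.Adj a b) (h : ∀ a b, a ≠ b → ∃ z, H.Adj z a ∧ H.Adj z b) :
    H.Connected ∧ ∃ a b c : V, H.Adj a b ∧ H.Adj b c ∧ H.Adj a c := by
  obtain ⟨a, b, hab⟩ := he
  constructor
  · haveI : Nonempty V := ⟨a⟩
    refine ⟨fun x y => ?_⟩
    by_cases hxy : x = y
    · exact hxy ▸ SimpleGraph.Reachable.refl _
    · obtain ⟨z, h1, h2⟩ := h x y hxy
      exact h1.symm.reachable.trans h2.reachable
  · obtain ⟨z, h1, h2⟩ := h a b hab.ne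
    exact ⟨a, b, z, hab, h2.symm, h1.symm⟩

/-- A strongly regular graph `G` with parameters `(v, k, λ, μ)` (having at least one
edge and at least one pair of distinct nonadjacent vertices) is 2-e.c. if and only if
both `G` and its complement are connected and both `G` and its complement contain a
triangle. -/
theorem stmt_5 {V : Type*} [Fintype V] [DecidableEq V]
    (G : SimpleGraph V) [DecidableRel G.Adj] (v k l m : ℕ)
    (hsrg : G.IsSRGWith v k l m)
    (hedge : ∃ a b : V, G.Adj a b)
    (hnonedge : ∃ a b : V, a ≠ b ∧ ¬ G.Adj a b) :
    G.IsNEC 2 ↔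
      (G.Connected ∧ Gᶜ.Connected ∧
        (∃ a b c : V, G.Adj a b ∧ G.Adj b c ∧ G.Adj a c) ∧
        (∃ a b c : V, Gᶜ.Adj a b ∧ Gᶜ.Adj b c ∧ Gᶜ.Adj a c)) := by
  constructor
  · intro h
    have h1 := aux3 G hedge (fun a b hab => by
      obtain ⟨z, -, hz, -⟩ := h {a, b} ∅ (by simp) (by simp [hab])
      exact ⟨z, hz a (by simp), hz b (by simp)⟩)
    have h2 := aux3 Gᶜ (by simpa [SimpleGraph.compl_adj] using hnonedge) (fun a b hab => by
      obtain ⟨z, hz0, -, hz⟩ := h ∅ {a, b} (by simp) (by simp [hab])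
      simp only [Finset.empty_union, Finset.mem_insert, Finset.mem_singleton, not_or] at hz0
      exact ⟨z, ⟨hz0.1, hz a (by simp)⟩, ⟨hz0.2, hz b (by simp)⟩⟩)
    exact ⟨h1.1, h2.1, h1.2, h2.2⟩
  · rintro ⟨c1, c2, t1, t2⟩
    have hn2 : ∃ a b : V, a ≠ b ∧ ¬ Gᶜ.Adj a b := by
      obtain ⟨a, b, hab⟩ := hedge
      exact ⟨a, b, hab.ne, fun h => h.2 hab⟩
    have A1 := aux1 G v k l m hsrg c1 hnonedge t1
    have A2 := aux1 Gᶜ _ _ _ _ hsrg.compl c2 hn2 t2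
    have B1 := aux2 G v k l m hsrg c1 hnonedge
    have B2 := aux2 Gᶜ _ _ _ _ hsrg.compl c2 hn2
    have B : ∀ a b, a ≠ b → ∃ z, z ≠ a ∧ z ≠ b ∧ G.Adj z a ∧ ¬ G.Adj z b := by
      intro a b hab
      by_cases h : G.Adj a b
      · obtain ⟨z, h1, h2, h3⟩ := B1 a b h
        exact ⟨z, h2.ne, h1, h2, h3⟩
      · obtain ⟨z, h1, h2, h3⟩ := B2 b a ⟨hab.symm, fun h' => h h'.symm⟩
        refine ⟨z, h1, h2.1, ?_, h2.2⟩
        by_contra h4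
        exact h3 ⟨h1, h4⟩
    intro A B' hd hcard
    obtain ⟨x, y, hxy, hU⟩ := Finset.card_eq_two.1 hcard
    have mem : ∀ z, z ∈ A ∨ z ∈ B' ↔ z = x ∨ z = y := by
      intro z
      rw [← Finset.mem_union, hU]; simp
    have dis : ∀ z, z ∈ A → z ∉ B' := fun z h1 h2 => Finset.disjoint_left.1 hd h1 h2
    rw [hU]
    simp only [Finset.mem_insert, Finset.mem_singleton, not_or]
    rcases (mem x).2 (Or.inl rfl) with hx | hx <;> rcases (mem y).2 (Or.inr rfl) with hy | hy
    · obtain ⟨z, h1, h2⟩ := A1 x y hxy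
      exact ⟨z, ⟨h1.ne, h2.ne⟩, by grind, by grind⟩
    · obtain ⟨z, h1, h2, h3, h4⟩ := B x y hxy
      exact ⟨z, ⟨h1, h2⟩, by grind, by grind⟩
    · obtain ⟨z, h1, h2, h3, h4⟩ := B y x hxy.symm
      exact ⟨z, ⟨h2, h1⟩, by grind, by grind⟩
    · obtain ⟨z, h1, h2⟩ := A2 x y hxy
      have := h1.2
      have := h2.2
      exact ⟨z, ⟨h1.1, h2.1⟩, by grind, by grind⟩
end

section
/- If G is a 3-e.c. strongly regular graph with parameters (v, k, λ, μ), then μ·(k − λ − 3) ≥ v − 2k + μ − 2. -/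
/-- If `G` is a 3-e.c. strongly regular graph with parameters `(v, k, λ, μ)`
(having at least one edge and at least one pair of distinct nonadjacent vertices),
then `μ·(k − λ − 3) ≥ v − 2k + μ − 2`. -/
theorem stmt_12 {V : Type*} [Fintype V] [DecidableEq V]
    (G : SimpleGraph V) [DecidableRel G.Adj] (v k l m : ℕ)
    (hsrg : G.IsSRGWith v k l m)
    (hedge : ∃ a b : V, G.Adj a b)
    (hnonedge : ∃ a b : V, a ≠ b ∧ ¬ G.Adj a b)
    (hec : G.IsNEC 3) :
    (m : ℤ) * ((k : ℤ) - (l : ℤ) - 3) ≥ (v : ℤ) - 2 * (k : ℤ) + (m : ℤ) - 2 := by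
  obtain ⟨x, y, hxy, hnadj⟩ := hnonedge
  have hnadj' : ¬ G.Adj y x := fun h => hnadj h.symm
  set U : Finset V := (G.neighborFinset x ∪ G.neighborFinset y) ∪ {x, y} with hU
  set M : Finset V := G.neighborFinset x ∩ G.neighborFinset y with hM
  have hMcard : M.card = m := by
    have h := hsrg.of_not_adj hxy hnadj
    rw [← h, ← Set.toFinset_card]
    congr 1
    ext w
    simp [hM, SimpleGraph.mem_commonNeighbors]
  have hdeg : ∀ w, (G.neighborFinset w).card = k := fun w => by
    rw [SimpleGraph.card_neighborFinset_eq_degree]; exact hsrg.regular w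
  have hUcard : U.card + m ≤ 2 * k + 2 := by
    have h1 := Finset.card_union_add_card_inter (G.neighborFinset x) (G.neighborFinset y)
    have h2 := Finset.card_union_le (G.neighborFinset x ∪ G.neighborFinset y) {x, y}
    have h3 : ({x, y} : Finset V).card = 2 := Finset.card_pair hxy
    rw [← hM, hMcard, hdeg, hdeg] at h1
    rw [h3, ← hU] at h2
    omega
  have hNcard : Uᶜ.card + U.card = v := by
    rw [Finset.card_compl_add_card, hsrg.card]
  have hcover : Uᶜ ⊆ M.biUnion (fun w => Uᶜ ∩ G.neighborFinset w) := by
    intro z hz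
    have hz' := hz
    simp only [hU, Finset.mem_compl, Finset.mem_union, Finset.mem_insert,
      Finset.mem_singleton, SimpleGraph.mem_neighborFinset, not_or] at hz'
    obtain ⟨⟨_, _⟩, hzx, hzy⟩ := hz'
    obtain ⟨w, _, hw, _⟩ := hec {x, y, z} ∅ (by simp) (by
      rw [Finset.union_empty]
      exact Finset.card_eq_three.2 ⟨x, y, z, hxy, Ne.symm hzx, Ne.symm hzy, rfl⟩)
    rw [Finset.mem_biUnion]
    refine ⟨w, ?_, ?_⟩
    · simp only [hM, Finset.mem_inter, SimpleGraph.mem_neighborFinset]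
      exact ⟨(hw x (by simp)).symm, (hw y (by simp)).symm⟩
    · rw [Finset.mem_inter, SimpleGraph.mem_neighborFinset]
      exact ⟨hz, hw z (by simp)⟩
  have hbound : ∀ w ∈ M, (Uᶜ ∩ G.neighborFinset w).card ≤ k - l - 3 ∧ l + 3 ≤ k := by
    intro w hw
    simp only [hM, Finset.mem_inter, SimpleGraph.mem_neighborFinset] at hw
    obtain ⟨hxw, hyw⟩ := hw
    obtain ⟨u, hu, huA, huB⟩ := hec {y, w} {x} (by
      simp [hxy, hxw.ne]) (by
      rw [Finset.card_eq_three]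
      refine ⟨y, w, x, hyw.ne, hxy.symm, hxw.ne', ?_⟩
      ext a; simp)
    have huy := huA y (by simp)
    have huw := huA w (by simp)
    have hux := huB x (by simp)
    have hunx : u ≠ x := by rintro rfl; exact hnadj huy
    have h3 : ({x, y, u} : Finset V).card = 3 :=
      Finset.card_eq_three.2 ⟨x, y, u, hxy, hunx.symm, huy.ne', rfl⟩
    have hl : (G.neighborFinset w ∩ G.neighborFinset x).card = l := by
      have h := hsrg.of_adj w x hxw.symm
      rw [← h, ← Set.toFinset_card]
      congr 1
      ext w
      simp [SimpleGraph.mem_commonNeighbors]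
    have hd1 : Disjoint (G.neighborFinset w ∩ G.neighborFinset x) {x, y, u} := by
      rw [Finset.disjoint_left]
      intro a ha hb
      simp only [Finset.mem_inter, SimpleGraph.mem_neighborFinset, Finset.mem_insert,
        Finset.mem_singleton] at ha hb
      rcases hb with rfl | rfl | rfl
      · exact G.loopless.irrefl _ ha.2
      · exact hnadj ha.2
      · exact hux ha.2.symm
    have hd2 : Disjoint (Uᶜ ∩ G.neighborFinset w)
        ((G.neighborFinset w ∩ G.neighborFinset x) ∪ {x, y, u}) := by
      rw [Finset.disjoint_left]
      intro a ha hb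
      simp only [hU, Finset.mem_compl, Finset.mem_union, Finset.mem_inter,
        SimpleGraph.mem_neighborFinset, Finset.mem_insert,
        Finset.mem_singleton, not_or] at ha hb
      obtain ⟨⟨⟨h1, h2⟩, h4, h5⟩, _⟩ := ha
      rcases hb with hb | rfl | rfl | rfl
      · exact h1 hb.2
      · exact h4 rfl
      · exact h5 rfl
      · exact h2 huy.symm
    have hsub : (Uᶜ ∩ G.neighborFinset w) ∪
        ((G.neighborFinset w ∩ G.neighborFinset x) ∪ {x, y, u}) ⊆ G.neighborFinset w := by
      intro a ha
      simp only [Finset.mem_union, Finset.mem_inter, Finset.mem_insert,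
        Finset.mem_singleton] at ha
      rw [SimpleGraph.mem_neighborFinset] at *
      rcases ha with ha | ha | rfl | rfl | rfl
      · exact ha.2
      · exact ha.1
      · exact hxw.symm
      · exact hyw.symm
      · exact huw.symm
    have hc := Finset.card_le_card hsub
    rw [Finset.card_union_of_disjoint hd2, Finset.card_union_of_disjoint hd1, h3, hl, hdeg] at hc
    omega
  have hsum : (Uᶜ.card : ℤ) ≤ (m : ℤ) * ((k : ℤ) - (l : ℤ) - 3) := by
    have h1 : Uᶜ.card ≤ m * (k - l - 3) := by
      rw [← hMcard]
      exact (Finset.card_le_card hcover).trans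
        (Finset.card_biUnion_le_card_mul _ _ _ fun w hw => (hbound w hw).1)
    rcases M.eq_empty_or_nonempty with he | ⟨w, hw⟩
    · have : m = 0 := by rw [← hMcard, he]; rfl
      subst this
      simp at h1 ⊢
      exact h1
    · have h2 := (hbound w hw).2
      have h3 : ((k - l - 3 : ℕ) : ℤ) = (k : ℤ) - l - 3 := by omega
      rw [← h3]
      exact_mod_cast h1
  have : (v : ℤ) - 2 * (k : ℤ) + (m : ℤ) - 2 ≤ Uᶜ.card := by omega
  exact this.trans hsum
end

section
/- Let G be a 3-e.c. point graph of a nondegenerate partial geometry pg(s, 2, 2), let x be a vertex of G, and let H be the subgraph induced on the neighbourhood of x, whose vertex set partitions into three cliques C₁, C₂, C₃ of size s − 1 (one for each of the three lines through x, minus x). Then every pair of adjacent vertices u ∈ C₁ and v ∈ C₂ has a common neighbour w ∈ C₃; consequently the edges of H not contained within C₁, C₂, or C₃ can be partitioned into vertex-disjoint triangles. -/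
/-- A (finite) partial geometry `pg(s, t, α)` with point type `P` and line type `L`:
every line is incident with exactly `s+1` points, every point is incident with
exactly `t+1` lines, any two distinct points lie on at most one common line, and
for every point `p` not incident with a line `l` there are exactly `α` lines
through `p` meeting `l`. -/
structure PartialGeometry (P : Type*) (Lines : Type*) [Fintype P] [Fintype Lines]
    (s t a : ℕ) where
  Incid : P → Lines → Prop
  line_size : ∀ l : Lines, {p : P | Incid p l}.ncard = s + 1
  point_lines : ∀ p : P, {l : Lines | Incid p l}.ncard = t + 1
  unique_line : ∀ p q : P, ∀ l m : Lines, p ≠ q →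
    Incid p l → Incid q l → Incid p m → Incid q m → l = m
  alpha_lines : ∀ (p : P) (l : Lines), ¬ Incid p l →
    {m : Lines | Incid p m ∧ ∃ q : P, Incid q l ∧ Incid q m}.ncard = a

/-- The point graph of a partial geometry: vertices are the points, and two
distinct points are adjacent iff they are collinear. -/
def PartialGeometry.pointGraph {P Lines : Type*} [Fintype P] [Fintype Lines]
    {s t a : ℕ} (PG : PartialGeometry P Lines s t a) : SimpleGraph P where
  Adj p q := p ≠ q ∧ ∃ l : Lines, PG.Incid p l ∧ PG.Incid q l
  symm := by
    constructor
    rintro p q ⟨hpq, l, hp, hq⟩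
    exact ⟨hpq.symm, l, hq, hp⟩
  loopless := by constructor; rintro p ⟨hp, -⟩; exact hp rfl

theorem pg_uniq {P Lines : Type*} [Fintype P] [Fintype Lines] {s : ℕ}
    (PG : PartialGeometry P Lines s 2 2) {x p q q' : P} {l l' : Lines} (hl : l ≠ l')
    (hx : PG.Incid x l) (hx' : PG.Incid x l') (hp : PG.Incid p l) (hpx : p ≠ x)
    (hq : PG.Incid q l') (hqx : q ≠ x) (hq' : PG.Incid q' l') (hqx' : q' ≠ x)
    (h : PG.pointGraph.Adj p q) (h' : PG.pointGraph.Adj p q') : q = q' := by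
  obtain ⟨-, m, hm1, hm2⟩ := h
  obtain ⟨-, m', hm1', hm2'⟩ := h'
  have hpl : ¬ PG.Incid p l' := fun hh => hl (PG.unique_line p x l l' hpx hp hx hh hx')
  have hlm : l ≠ m := by
    rintro rfl
    exact hl (PG.unique_line q x l l' hqx hm2 hx hq hx')
  have hlm' : l ≠ m' := by
    rintro rfl
    exact hl (PG.unique_line q' x l l' hqx' hm2' hx hq' hx')
  obtain ⟨a, b, hab, hS⟩ := Set.ncard_eq_two.mp (PG.alpha_lines p l' hpl)
  have e1 : l ∈ ({a, b} : Set Lines) := hS ▸ ⟨hp, x, hx', hx⟩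
  have e2 : m ∈ ({a, b} : Set Lines) := hS ▸ ⟨hm1, q, hq, hm2⟩
  have e3 : m' ∈ ({a, b} : Set Lines) := hS ▸ ⟨hm1', q', hq', hm2'⟩
  simp only [Set.mem_insert_iff, Set.mem_singleton_iff] at e1 e2 e3
  have hmm : m = m' := by grind
  subst hmm
  by_contra hne
  have := PG.unique_line q q' m l' hne hm2 hm2' hq hq'
  exact hpl (this ▸ hm1)

theorem pg_third {P Lines : Type*} [Fintype P] [Fintype Lines] [DecidableEq P] {s : ℕ}
    (PG : PartialGeometry P Lines s 2 2) (hec : PG.pointGraph.IsNEC 3)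
    {x : P} {l₁ l₂ l₃ : Lines}
    (h12 : l₁ ≠ l₂) (h13 : l₁ ≠ l₃) (h23 : l₂ ≠ l₃)
    (hx1 : PG.Incid x l₁) (hx2 : PG.Incid x l₂) (hx3 : PG.Incid x l₃) {u v : P}
    (hu : PG.Incid u l₁) (hux : u ≠ x) (hv : PG.Incid v l₂) (hvx : v ≠ x)
    (h : PG.pointGraph.Adj u v) :
    ∃ w, (PG.Incid w l₃ ∧ w ≠ x) ∧ PG.pointGraph.Adj u w ∧ PG.pointGraph.Adj v w := by
  obtain ⟨z, hz, hA, -⟩ := hec {x, u, v} ∅ (by simp) (by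
    rw [Finset.union_empty, Finset.card_eq_three]
    exact ⟨x, u, v, hux.symm, hvx.symm, h.ne, rfl⟩)
  simp only [Finset.union_empty, Finset.mem_insert, Finset.mem_singleton, not_or] at hz
  have hzu := hA u (by simp)
  have hzv := hA v (by simp)
  obtain ⟨-, m, hzm, hxm⟩ := hA x (by simp)
  obtain ⟨a, b, c, hab, hac, hbc, hS⟩ := Set.ncard_eq_three.mp (PG.point_lines x)
  have e1 : l₁ ∈ ({a, b, c} : Set Lines) := hS ▸ hx1
  have e2 : l₂ ∈ ({a, b, c} : Set Lines) := hS ▸ hx2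
  have e3 : l₃ ∈ ({a, b, c} : Set Lines) := hS ▸ hx3
  have e4 : m ∈ ({a, b, c} : Set Lines) := hS ▸ hxm
  simp only [Set.mem_insert_iff, Set.mem_singleton_iff] at e1 e2 e3 e4
  have : m = l₁ ∨ m = l₂ ∨ m = l₃ := by grind
  rcases this with rfl | rfl | rfl
  · exact absurd (pg_uniq PG h12.symm hx2 hx1 hv hvx hzm hz.1 hu hux hzv.symm h.symm) hz.2.1
  · exact absurd (pg_uniq PG h12 hx1 hx2 hu hux hzm hz.1 hv hvx hzu.symm h) hz.2.2
  · exact ⟨z, ⟨hzm, hz.1⟩, hzu.symm, hzv.symm⟩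

/-- Let `G` be a 3-e.c. point graph of a nondegenerate partial geometry `pg(s, 2, 2)`,
let `x` be a vertex, and let `C₁, C₂, C₃` be the three cliques of size `s − 1` in the
neighbourhood of `x` given by the three lines `l₁, l₂, l₃` through `x` (minus `x`).
Then every pair of adjacent vertices `u ∈ C₁`, `v ∈ C₂` has a common neighbour
`w ∈ C₃`; consequently the edges of the neighbourhood of `x` not contained within
`C₁`, `C₂`, or `C₃` can be partitioned into vertex-disjoint triangles. -/
theorem stmt_16 {P Lines : Type*} [Fintype P] [Fintype Lines] [DecidableEq P]
    (s : ℕ) (hs : 2 ≤ s)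
    (PG : PartialGeometry P Lines s 2 2)
    (hec : PG.pointGraph.IsNEC 3)
    (x : P) (l₁ l₂ l₃ : Lines)
    (h12 : l₁ ≠ l₂) (h13 : l₁ ≠ l₃) (h23 : l₂ ≠ l₃)
    (hx1 : PG.Incid x l₁) (hx2 : PG.Incid x l₂) (hx3 : PG.Incid x l₃)
    (C₁ C₂ C₃ : Set P)
    (hC1 : C₁ = {p : P | PG.Incid p l₁ ∧ p ≠ x})
    (hC2 : C₂ = {p : P | PG.Incid p l₂ ∧ p ≠ x})
    (hC3 : C₃ = {p : P | PG.Incid p l₃ ∧ p ≠ x}) :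
    (∀ u ∈ C₁, ∀ v ∈ C₂, PG.pointGraph.Adj u v →
      ∃ w ∈ C₃, PG.pointGraph.Adj u w ∧ PG.pointGraph.Adj v w) ∧
    ∃ 𝒯 : Set (Set P),
      𝒯.PairwiseDisjoint id ∧
      (∀ T ∈ 𝒯, ∃ u ∈ C₁, ∃ v ∈ C₂, ∃ w ∈ C₃, T = {u, v, w} ∧
        PG.pointGraph.Adj u v ∧ PG.pointGraph.Adj v w ∧ PG.pointGraph.Adj u w) ∧
      (∀ u v : P, PG.pointGraph.Adj u v →
        u ∈ C₁ ∪ C₂ ∪ C₃ → v ∈ C₁ ∪ C₂ ∪ C₃ →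
        ¬ (u ∈ C₁ ∧ v ∈ C₁) → ¬ (u ∈ C₂ ∧ v ∈ C₂) → ¬ (u ∈ C₃ ∧ v ∈ C₃) →
        ∃ T ∈ 𝒯, u ∈ T ∧ v ∈ T) := by
  subst hC1 hC2 hC3
  refine ⟨?_, {T | ∃ u ∈ {p : P | PG.Incid p l₁ ∧ p ≠ x}, ∃ v ∈ {p : P | PG.Incid p l₂ ∧ p ≠ x},
    ∃ w ∈ {p : P | PG.Incid p l₃ ∧ p ≠ x}, T = {u, v, w} ∧
        PG.pointGraph.Adj u v ∧ PG.pointGraph.Adj v w ∧ PG.pointGraph.Adj u w}, ?_, ?_, ?_⟩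
  · rintro u ⟨hu, hux⟩ v ⟨hv, hvx⟩ h
    exact pg_third PG hec h12 h13 h23 hx1 hx2 hx3 hu hux hv hvx h
  · rintro T ⟨u, ⟨hu, hux⟩, v, ⟨hv, hvx⟩, w, ⟨hw, hwx⟩, rfl, huv, hvw, huw⟩
      T' ⟨u', ⟨hu', hux'⟩, v', ⟨hv', hvx'⟩, w', ⟨hw', hwx'⟩, rfl, huv', hvw', huw'⟩ hne
    have key : ∀ (p : P) (l l' : Lines), l ≠ l' → PG.Incid x l → PG.Incid x l' → p ≠ x →
        PG.Incid p l → PG.Incid p l' → False := fun p l l' hl h1 h2 hp h3 h4 =>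
      hl (PG.unique_line p x l l' hp h3 h1 h4 h2)
    have fu : u = u' → v = v' ∧ w = w' := by
      rintro rfl
      exact ⟨pg_uniq PG h12 hx1 hx2 hu hux hv hvx hv' hvx' huv huv',
        pg_uniq PG h13 hx1 hx3 hu hux hw hwx hw' hwx' huw huw'⟩
    have fv : v = v' → u = u' := by
      rintro rfl
      exact pg_uniq PG h12.symm hx2 hx1 hv hvx hu hux hu' hux' huv.symm huv'.symm
    have fw : w = w' → u = u' := by
      rintro rfl
      exact pg_uniq PG h13.symm hx3 hx1 hw hwx hu hux hu' hux' huw.symm huw'.symm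
    have hn : u ≠ u' := by
      intro h
      obtain ⟨h1, h2⟩ := fu h
      subst h h1 h2
      exact hne rfl
    refine Set.disjoint_left.mpr ?_
    intro p hp hp'
    simp only [id, Set.mem_insert_iff, Set.mem_singleton_iff] at hp hp'
    rcases hp with rfl | rfl | rfl <;> rcases hp' with h | h | h
    · exact hn h
    · exact key _ _ _ h12 hx1 hx2 hux hu (h ▸ hv')
    · exact key _ _ _ h13 hx1 hx3 hux hu (h ▸ hw')
    · exact key _ _ _ h12 hx1 hx2 hvx (h ▸ hu') hv
    · exact hn (fv h)
    · exact key _ _ _ h23 hx2 hx3 hvx hv (h ▸ hw')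
    · exact key _ _ _ h13 hx1 hx3 hwx (h ▸ hu') hw
    · exact key _ _ _ h23 hx2 hx3 hwx (h ▸ hv') hw
    · exact hn (fw h)
  · exact fun T hT => hT
  · intro u v h hu hv n1 n2 n3
    have g12 : ∀ u v, PG.pointGraph.Adj u v → (PG.Incid u l₁ ∧ u ≠ x) → (PG.Incid v l₂ ∧ v ≠ x) →
        ∃ w, (PG.Incid w l₃ ∧ w ≠ x) ∧ PG.pointGraph.Adj u w ∧ PG.pointGraph.Adj v w :=
      fun u v h hu hv => pg_third PG hec h12 h13 h23 hx1 hx2 hx3 hu.1 hu.2 hv.1 hv.2 h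
    have g13 : ∀ u v, PG.pointGraph.Adj u v → (PG.Incid u l₁ ∧ u ≠ x) → (PG.Incid v l₃ ∧ v ≠ x) →
        ∃ w, (PG.Incid w l₂ ∧ w ≠ x) ∧ PG.pointGraph.Adj u w ∧ PG.pointGraph.Adj v w :=
      fun u v h hu hv => pg_third PG hec h13 h12 h23.symm hx1 hx3 hx2 hu.1 hu.2 hv.1 hv.2 h
    have g23 : ∀ u v, PG.pointGraph.Adj u v → (PG.Incid u l₂ ∧ u ≠ x) → (PG.Incid v l₃ ∧ v ≠ x) →
        ∃ w, (PG.Incid w l₁ ∧ w ≠ x) ∧ PG.pointGraph.Adj u w ∧ PG.pointGraph.Adj v w :=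
      fun u v h hu hv => pg_third PG hec h23 h12.symm h13.symm hx2 hx3 hx1 hu.1 hu.2 hv.1 hv.2 h
    rcases hu with (hu | hu) | hu <;> rcases hv with (hv | hv) | hv
    · exact absurd ⟨hu, hv⟩ n1
    · obtain ⟨w, hw, a, b⟩ := g12 u v h hu hv
      exact ⟨{u, v, w}, ⟨u, hu, v, hv, w, hw, rfl, h, b, a⟩, by simp, by simp⟩
    · obtain ⟨w, hw, a, b⟩ := g13 u v h hu hv
      exact ⟨{u, w, v}, ⟨u, hu, w, hw, v, hv, rfl, a, b.symm, h⟩, by simp, by simp⟩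
    · obtain ⟨w, hw, a, b⟩ := g12 v u h.symm hv hu
      exact ⟨{v, u, w}, ⟨v, hv, u, hu, w, hw, rfl, h.symm, b, a⟩, by simp, by simp⟩
    · exact absurd ⟨hu, hv⟩ n2
    · obtain ⟨w, hw, a, b⟩ := g23 u v h hu hv
      exact ⟨{w, u, v}, ⟨w, hw, u, hu, v, hv, rfl, a.symm, h, b.symm⟩, by simp, by simp⟩
    · obtain ⟨w, hw, a, b⟩ := g13 v u h.symm hv hu
      exact ⟨{v, w, u}, ⟨v, hv, w, hw, u, hu, rfl, a, b.symm, h.symm⟩, by simp, by simp⟩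
    · obtain ⟨w, hw, a, b⟩ := g23 v u h.symm hv hu
      exact ⟨{w, v, u}, ⟨w, hw, v, hv, u, hu, rfl, a.symm, h.symm, b.symm⟩, by simp, by simp⟩
    · exact absurd ⟨hu, hv⟩ n3
end
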